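/- Let P be a nontrivial finite abelian p-group, let r be the rank of the elementary abelian p-group P/Φ(P) (where Φ(P) is the Frattini subgroup of P), and let E be a nontrivial abelian p'-subgroup of Aut(P) acting freely on P∖{1}. Set H = P⋊E. Then the sum, over a complete set of representatives x of the conjugacy classes of H, of the dimensions dim_k Hom(C_H(x), k) equals r·(|P|−1)/|E|. (By the centraliser decomposition, this sum equals dim_k HH^1(kH).) -/

import Mathlib

section HomToField

variable {k : Type*} [Field k]

theorem AddMonoidHom.subsingleton_of_natCard_ne_zero {G : Type*} [Group G] [Finite G]
    (h : (Nat.card G : k) ≠ 0) : Subsingleton (Additive G →+ k) := by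
  refine subsingleton_of_forall_eq 0 fun f => AddMonoidHom.ext fun g => ?_
  have hg : Nat.card G • g = 0 := by
    rw [← ofMul_toMul g, ← ofMul_pow, pow_card_eq_one', ofMul_one]
  have := congrArg f hg
  rw [map_nsmul, map_zero, nsmul_eq_mul] at this
  exact (mul_eq_zero.mp this).resolve_left h

/-- If every homomorphism `G → k` factors through the surjection `φ : G → H`, then `Hom(G, k)` and
`Hom(H, k)` have the same dimension. -/
theorem AddMonoidHom.finrank_eq_of_surjective {G H : Type*} [Group G] [Group H] (φ : G →* H)
    (hφ : Function.Surjective φ) (hker : ∀ f : Additive G →+ k, ∀ g ∈ φ.ker, f (.ofMul g) = 0) :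
    Module.finrank k (Additive G →+ k) = Module.finrank k (Additive H →+ k) := by
  let L : (Additive H →+ k) →ₗ[k] (Additive G →+ k) :=
    { toFun := fun f => f.comp (MonoidHom.toAdditive φ)
      map_add' := fun _ _ => rfl
      map_smul' := fun _ _ => rfl }
  refine (LinearEquiv.ofBijective L ⟨fun f f' h => ?_, fun f => ?_⟩).finrank_eq.symm
  · refine AddMonoidHom.ext fun x => ?_
    obtain ⟨g, rfl⟩ : ∃ g, φ g = x := hφ (Additive.toMul x)
    exact DFunLike.congr_fun h (Additive.ofMul g)
  · refine ⟨AddMonoidHom.liftOfSurjective (MonoidHom.toAdditive φ) hφ ⟨f, fun g hg => ?_⟩, ?_⟩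
    · exact hker f g.toMul hg
    · exact AddMonoidHom.liftOfRightInverse_comp _ _ _ _

theorem AddMonoidHom.finrank_eq_finrank_zmod_linearMap {k : Type*} [Field k] (p : ℕ)
    [Algebra (ZMod p) k] (V : Type*) [AddCommGroup V] [Module (ZMod p) V] :
    Module.finrank k (V →+ k) = Module.finrank k (V →ₗ[ZMod p] k) := by
  let e : (V →+ k) ≃ₗ[k] (V →ₗ[ZMod p] k) :=
    { toFun := fun f => f.toZModLinearMap p
      invFun := fun f => f.toAddMonoidHom
      map_add' := fun _ _ => rfl
      map_smul' := fun _ _ => rfl }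
  exact e.finrank_eq

end HomToField

section Frattini

theorem Subgroup.pow_mem_of_isCoatom {P : Type*} [CommGroup P] {p : ℕ} (hp : p.Prime)
    (hP : IsPGroup p P) {M : Subgroup P} (hM : IsCoatom M) (x : P) : x ^ p ∈ M := by
  have : Fact p.Prime := ⟨hp⟩
  have : IsSimpleGroup (P ⧸ M) :=
    { exists_pair_ne := by
        have : Nontrivial (P ⧸ M) := QuotientGroup.nontrivial_iff.mpr hM.1
        exact exists_pair_ne _
      eq_bot_or_eq_top_of_normal := fun H _ => by
        have hsurj := QuotientGroup.mk'_surjective M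
        rcases hM.le_iff.mp (QuotientGroup.le_comap_mk' M H) with h | h
        · right
          rw [← Subgroup.map_comap_eq_self_of_surjective hsurj H, h,
            Subgroup.map_top_of_surjective _ hsurj]
        · left
          rw [← Subgroup.map_comap_eq_self_of_surjective hsurj H, h, QuotientGroup.map_mk'_self] }
  have hprime : (Nat.card (P ⧸ M)).Prime := IsSimpleGroup.prime_card
  have : Finite (P ⧸ M) := Nat.finite_of_card_ne_zero hprime.ne_zero
  obtain ⟨n, hn⟩ := (hP.to_quotient M).exists_card_eq
  have hcard : Nat.card (P ⧸ M) = p := by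
    rw [hn] at hprime ⊢
    rw [hprime.eq_one_of_pow, pow_one]
  rw [← QuotientGroup.eq_one_iff, QuotientGroup.mk_pow, ← hcard, pow_card_eq_one']

theorem IsPGroup.pow_mem_frattini {P : Type*} [CommGroup P] {p : ℕ} (hp : p.Prime)
    (hP : IsPGroup p P) (x : P) : x ^ p ∈ frattini P := by
  simp only [frattini, Order.radical, Subgroup.mem_iInf]
  exact fun M hM => Subgroup.pow_mem_of_isCoatom hp hP hM x

theorem frattini_multiplicative_zmod {p : ℕ} [Fact p.Prime] :
    frattini (Multiplicative (ZMod p)) = ⊥ := by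
  have : IsSimpleGroup (Multiplicative (ZMod p)) :=
    isSimpleGroup_of_prime_card (p := p) (by simp)
  rw [eq_bot_iff]
  refine frattini_le_coatom ⟨bot_ne_top, fun H hH => ?_⟩
  exact (IsSimpleGroup.eq_bot_or_eq_top_of_normal H inferInstance).resolve_left hH.ne'

theorem AddMonoidHom.apply_eq_zero_of_mem_frattini {k : Type*} [Field k] {p : ℕ} [Fact p.Prime]
    [CharP k p] {P : Type*} [Group P] (f : Additive P →+ k) {x : P} (hx : x ∈ frattini P) :
    f (.ofMul x) = 0 := by
  let := ZMod.algebra k p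
  rw [← Module.forall_dual_apply_eq_zero_iff (ZMod p)]
  intro l
  by_contra hne
  let g : P →* Multiplicative (ZMod p) :=
    AddMonoidHom.toMultiplicativeRight (l.toAddMonoidHom.comp f)
  have hg : Function.Surjective g := by
    intro y
    let c : ZMod p := y.toAdd * (l (f (.ofMul x)))⁻¹
    refine ⟨x ^ c.val, ?_⟩
    apply Multiplicative.toAdd.injective
    change l (f (.ofMul (x ^ c.val))) = _
    rw [ofMul_pow, map_nsmul, map_nsmul, nsmul_eq_mul, ZMod.natCast_zmod_val,
      inv_mul_cancel_right₀ hne]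
  have := frattini_le_comap_frattini_of_surjective hg hx
  rw [frattini_multiplicative_zmod, Subgroup.mem_comap, Subgroup.mem_bot] at this
  exact hne this

theorem AddMonoidHom.natCard_eq_pow_finrank {k : Type*} [Field k] {p : ℕ} [Fact p.Prime]
    [CharP k p] (V : Type*) [AddCommGroup V] [Finite V] [Module (ZMod p) V] :
    Nat.card V = p ^ Module.finrank k (V →+ k) := by
  let := ZMod.algebra k p
  rw [AddMonoidHom.finrank_eq_finrank_zmod_linearMap p, Module.finrank_linearMap_self,
    Module.natCard_eq_pow_finrank (K := ZMod p) (V := V), Nat.card_zmod]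

theorem AddMonoidHom.finrank_eq_of_pow_eq_one {k : Type*} [Field k] {p : ℕ}
    [Fact p.Prime] [CharP k p] {Q : Type*} [CommGroup Q] [Finite Q] (hQ : ∀ x : Q, x ^ p = 1)
    {r : ℕ} (hr : Nat.card Q = p ^ r) : Module.finrank k (Additive Q →+ k) = r := by
  let : Module (ZMod p) (Additive Q) := AddCommGroup.zmodModule hQ
  have h : Nat.card Q = p ^ Module.finrank k (Additive Q →+ k) :=
    AddMonoidHom.natCard_eq_pow_finrank (Additive Q)
  exact Nat.pow_right_injective (Fact.out : p.Prime).two_le (h.symm.trans hr)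

theorem IsPGroup.finrank_hom_eq_of_card_quotient_frattini {k : Type*} [Field k] {p : ℕ}
    [Fact p.Prime] [CharP k p] {P : Type*} [CommGroup P] [Finite P] (hP : IsPGroup p P) {r : ℕ}
    (hr : Nat.card (P ⧸ frattini P) = p ^ r) : Module.finrank k (Additive P →+ k) = r := by
  rw [AddMonoidHom.finrank_eq_of_surjective (QuotientGroup.mk' (frattini P))
    (QuotientGroup.mk'_surjective _) fun f g hg => ?_]
  · refine AddMonoidHom.finrank_eq_of_pow_eq_one (fun x => ?_) hr
    obtain ⟨y, rfl⟩ := QuotientGroup.mk_surjective x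
    rw [← QuotientGroup.mk_pow, QuotientGroup.eq_one_iff]
    exact hP.pow_mem_frattini Fact.out y
  · rw [QuotientGroup.ker_mk'] at hg
    exact f.apply_eq_zero_of_mem_frattini (p := p) hg

end Frattini

namespace SemidirectProduct

variable {P : Type*} [CommGroup P] {E : Subgroup (MulAut P)}

theorem eq_inl_left {x : P ⋊[E.subtype] E} (hx : x.right = 1) : x = inl x.left :=
  SemidirectProduct.ext rfl hx

theorem exists_apply_left_eq_of_isConj {x : P ⋊[E.subtype] E} {y : P} (h : IsConj x (inl y)) :
    x.right = 1 ∧ ∃ e : E, (e : MulAut P) x.left = y := by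
  obtain ⟨c, hc⟩ := isConj_iff.mp h
  have hr : x.right = 1 := by
    have := congrArg SemidirectProduct.right hc
    simpa [mul_inv_eq_one] using this
  refine ⟨hr, c.right, ?_⟩
  have := congrArg SemidirectProduct.left hc
  simpa [hr] using this

theorem card_mul_card_eq_of_isConj_representatives [Fintype P]
    (hfree : ∀ e : E, e ≠ 1 → ∀ x : P, x ≠ 1 → (e : MulAut P) x ≠ x)
    {S : Finset (P ⋊[E.subtype] E)} (hS : ∀ x ∈ S, x.right = 1 ∧ x ≠ 1)
    (hSinj : ∀ x ∈ S, ∀ y ∈ S, IsConj x y → x = y)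
    (hSsurj : ∀ y : P, y ≠ 1 → ∃ x ∈ S, IsConj x (inl y)) :
    S.card * Nat.card E = Fintype.card P - 1 := by
  classical
  have hleft : ∀ x ∈ S, x.left ≠ 1 := fun x hx h =>
    (hS x hx).2 (SemidirectProduct.ext h (hS x hx).1)
  let F : S × E → {y : P // y ≠ 1} := fun xe =>
    ⟨(xe.2 : MulAut P) xe.1.1.left, by
      simpa using hleft xe.1.1 xe.1.2⟩
  have hF : Function.Bijective F := by
    constructor
    · rintro ⟨⟨x, hx⟩, e⟩ ⟨⟨x', hx'⟩, e'⟩ h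
      have h : (e : MulAut P) x.left = (e' : MulAut P) x'.left := congrArg Subtype.val h
      have hconj : ∀ z ∈ S, ∀ a : E, IsConj z (inl ((a : MulAut P) z.left)) := fun z hz a =>
        isConj_iff.mpr ⟨inr a, by
          rw [← Subgroup.subtype_apply, inl_aut, ← eq_inl_left (hS z hz).1, map_inv]⟩
      obtain rfl : x = x' := hSinj x hx x' hx' <|
        (hconj x hx e).trans (h ▸ (hconj x' hx' e').symm)
      have he : e'⁻¹ * e = 1 := by
        by_contra hne
        refine hfree _ hne _ (hleft x hx) ?_
        simp [MulAut.mul_apply, h]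
      rw [inv_mul_eq_one.mp he]
    · rintro ⟨y, hy⟩
      obtain ⟨x, hx, hxy⟩ := hSsurj y hy
      obtain ⟨-, e, he⟩ := exists_apply_left_eq_of_isConj hxy
      exact ⟨⟨⟨x, hx⟩, e⟩, Subtype.ext he⟩
  have := Nat.card_eq_of_bijective F hF
  rw [Nat.card_prod, Nat.card_eq_fintype_card (α := S), Fintype.card_coe,
    Nat.card_eq_fintype_card (α := {y : P // y ≠ 1}), Fintype.card_subtype_compl] at this
  simpa using this

theorem finrank_hom_centralizer_inl {k : Type*} [Field k]
    (hfree : ∀ e : E, e ≠ 1 → ∀ x : P, x ≠ 1 → (e : MulAut P) x ≠ x) {y : P} (hy : y ≠ 1) :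
    Module.finrank k
      (Additive ↥(Subgroup.centralizer ({inl y} : Set (P ⋊[E.subtype] E))) →+ k) =
      Module.finrank k (Additive P →+ k) := by
  let φ : P →* Subgroup.centralizer ({inl y} : Set (P ⋊[E.subtype] E)) :=
    inl.codRestrict _ fun z => by
      rw [Subgroup.mem_centralizer_singleton_iff, ← map_mul, ← map_mul, mul_comm]
  refine (AddMonoidHom.finrank_eq_of_surjective φ ?_ ?_).symm
  · rintro ⟨c, hc⟩
    rw [Subgroup.mem_centralizer_singleton_iff] at hc
    have hcr : c.right = 1 := by
      by_contra hne
      refine hfree _ hne y hy ?_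
      have := congrArg SemidirectProduct.left hc
      exact mul_left_cancel (a := c.left) (by simpa [mul_comm y] using this)
    exact ⟨c.left, Subtype.ext (eq_inl_left hcr).symm⟩
  · intro f g hg
    have : g = 1 := inl_injective (φ := E.subtype) (congrArg Subtype.val hg)
    simp [this]

theorem subsingleton_hom_centralizer_of_right_ne_one {k : Type*} [Field k] [Finite P] {p : ℕ}
    [CharP k p] (hp : p.Prime) (hE : (Nat.card E).Coprime p)
    (hfree : ∀ e : E, e ≠ 1 → ∀ x : P, x ≠ 1 → (e : MulAut P) x ≠ x)
    {x : P ⋊[E.subtype] E} (hx : x.right ≠ 1) :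
    Subsingleton (Additive ↥(Subgroup.centralizer ({x} : Set (P ⋊[E.subtype] E))) →+ k) := by
  let C := Subgroup.centralizer ({x} : Set (P ⋊[E.subtype] E))
  let ψ : C →* E := rightHom.comp C.subtype
  have hψ : Function.Injective ψ := by
    rw [injective_iff_map_eq_one]
    rintro ⟨c, hc⟩ h
    have hcr : c.right = 1 := h
    rw [Subgroup.mem_centralizer_singleton_iff] at hc
    apply Subtype.ext
    refine SemidirectProduct.ext ?_ hcr
    by_contra hne
    refine hfree _ hx c.left hne ?_
    have := congrArg SemidirectProduct.left hc
    simpa [hcr, mul_comm] using this.symm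
  have : Finite C := Finite.of_injective ψ hψ
  refine AddMonoidHom.subsingleton_of_natCard_ne_zero fun h0 => ?_
  exact hp.coprime_iff_not_dvd.mp hE.symm
    (((CharP.cast_eq_zero_iff k p _).mp h0).trans (Subgroup.card_dvd_of_injective ψ hψ))

theorem subsingleton_hom_of_free {k : Type*} [Field k] [Finite P] {p : ℕ} [CharP k p]
    (hp : p.Prime) (hEnt : E ≠ ⊥) (hE : (Nat.card E).Coprime p)
    (hfree : ∀ e : E, e ≠ 1 → ∀ x : P, x ≠ 1 → (e : MulAut P) x ≠ x) :
    Subsingleton (Additive (P ⋊[E.subtype] E) →+ k) := by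
  refine subsingleton_of_forall_eq 0 fun f => AddMonoidHom.ext fun g => ?_
  have : Subsingleton (Additive E →+ k) := by
    refine AddMonoidHom.subsingleton_of_natCard_ne_zero fun h0 => ?_
    exact hp.coprime_iff_not_dvd.mp hE.symm ((CharP.cast_eq_zero_iff k p _).mp h0)
  have hinr : ∀ e : E, f (.ofMul (inr e)) = 0 := fun e =>
    DFunLike.congr_fun (Subsingleton.elim
      (f.comp (MonoidHom.toAdditive (inr (φ := E.subtype)))) 0) (.ofMul e)
  have hinl : ∀ y : P, f (.ofMul (inl y)) = 0 := by
    obtain ⟨a, ha, hne⟩ := E.bot_or_exists_ne_one.resolve_left hEnt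
    let e : E := ⟨a, ha⟩
    have he : e ≠ 1 := fun h => hne (congrArg Subtype.val h)
    let δ : P →* P := (e : MulAut P).toMonoidHom / MonoidHom.id P
    have hδ : Function.Injective δ := by
      rw [injective_iff_map_eq_one]
      intro y hy
      by_contra hy1
      exact hfree e he y hy1 (div_eq_one.mp hy)
    intro y
    obtain ⟨z, rfl⟩ := Finite.surjective_of_injective hδ y
    have hz : δ z = E.subtype e z / z := rfl
    rw [hz, map_div, inl_aut]
    simp [hinr, -map_inv]
  rw [← ofMul_toMul g, ← inl_left_mul_inr_right g.toMul, ofMul_mul, map_add, hinl, hinr, add_zero]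
  rfl

end SemidirectProduct


/-- Let `P` be a nontrivial finite abelian `p`-group, `r` the rank of the
elementary abelian `p`-group `P/Φ(P)` (i.e. `|P/Φ(P)| = p ^ r`), and `E` a nontrivial abelian
`p'`-subgroup of `Aut(P)` acting freely on `P ∖ {1}`.  Set `H = P ⋊ E`.  Then the sum, over a
complete set of representatives `x` of the conjugacy classes of `H`, of the dimensions
`dim_k Hom(C_H(x), k)` equals `r·(|P|−1)/|E|`.  (By the centraliser decomposition, this sum
equals `dim_k HH¹(kH)`.) -/
theorem sum_dim_hom_centralizers_semidirectProduct
    (p : ℕ) (hp : p.Prime)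
    (k : Type*) [Field k] [CharP k p] [IsAlgClosed k]
    (P : Type*) [CommGroup P] [Fintype P] [Nontrivial P] (hP : IsPGroup p P)
    (r : ℕ) (hr : Nat.card (P ⧸ frattini P) = p ^ r)
    (E : Subgroup (MulAut P)) (hEnt : E ≠ ⊥)
    (hEcomm : ∀ a b : E, a * b = b * a)
    (hE : (Nat.card E).Coprime p)
    (hfree : ∀ e : E, e ≠ 1 → ∀ x : P, x ≠ 1 → (e : MulAut P) x ≠ x)
    (R : Finset (P ⋊[E.subtype] E))
    (hR : ∀ h : P ⋊[E.subtype] E, ∃! x, x ∈ R ∧ IsConj x h) :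
    ∑ x ∈ R,
        Module.finrank k
          (Additive ↥(Subgroup.centralizer ({x} : Set (P ⋊[E.subtype] E))) →+ k) =
      r * ((Fintype.card P - 1) / Nat.card E) := by
  classical
  have : Fact p.Prime := ⟨hp⟩
  have hterm : ∀ x ∈ R, Module.finrank k
      (Additive ↥(Subgroup.centralizer ({x} : Set (P ⋊[E.subtype] E))) →+ k) =
      if x.right = 1 ∧ x ≠ 1 then r else 0 := by
    intro x _
    split_ifs with h
    · have hx := SemidirectProduct.eq_inl_left h.1
      have hy : x.left ≠ 1 := fun hl => h.2 (by rw [hx, hl, map_one])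
      rw [hx, SemidirectProduct.finrank_hom_centralizer_inl hfree hy]
      exact hP.finrank_hom_eq_of_card_quotient_frattini hr
    · by_cases hx : x.right = 1
      · obtain rfl : x = 1 := by tauto
        have hsub := SemidirectProduct.subsingleton_hom_of_free (k := k) hp hEnt hE hfree
        rw [AddMonoidHom.finrank_eq_of_surjective
          (Subgroup.centralizer ({1} : Set (P ⋊[E.subtype] E))).subtype
          (fun g => ⟨⟨g, by simp [Subgroup.mem_centralizer_singleton_iff]⟩, rfl⟩)
          (fun f g hg => by
            rw [show g = 1 from Subtype.ext hg]
            exact map_zero f)]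
        exact Module.finrank_zero_of_subsingleton
      · have := SemidirectProduct.subsingleton_hom_centralizer_of_right_ne_one (k := k) hp hE
          hfree hx
        exact Module.finrank_zero_of_subsingleton
  rw [Finset.sum_congr rfl hterm, ← Finset.sum_filter, Finset.sum_const, smul_eq_mul, mul_comm]
  congr 1
  refine (Nat.div_eq_of_eq_mul_left Nat.card_pos
    (SemidirectProduct.card_mul_card_eq_of_isConj_representatives hfree
      (fun x hx => (Finset.mem_filter.mp hx).2) ?_ ?_).symm).symm
  · intro x hx y hy hxy
    exact (hR y).unique ⟨(Finset.mem_filter.mp hx).1, hxy⟩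
      ⟨(Finset.mem_filter.mp hy).1, IsConj.refl y⟩
  · intro y hy
    obtain ⟨x, ⟨hxR, hxy⟩, -⟩ := hR (SemidirectProduct.inl y)
    obtain ⟨hr1, e, he⟩ := SemidirectProduct.exists_apply_left_eq_of_isConj hxy
    refine ⟨x, Finset.mem_filter.mpr ⟨hxR, hr1, ?_⟩, hxy⟩
    rintro rfl
    exact hy (by simpa using he.symm)
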